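/- Assume hypothesis (H.1) holds with α = 1/(2ℓ+1) for an integer ℓ ≥ 1, and assume D_1(j,j) ≥ 0 for all j ≥ 0; set ξ_{j,1} = √(D_1(j,j)). Then for every t > 0 and every fixed integer x ≥ 0, lim_{n→∞} n^{−2β/α} Σ_{j=0}^{⌊nt⌋−1−x} ξ_{j,1}^{2ℓ+1} ξ_{j+x,1}^{2ℓ+1} = (α/(2β)) (2λ)^{2ℓ+1} t^{2β/α}. -/

import Mathlib

open Real Filter Finset Topology

/-- The covariance function `R(s,t)` of the centered `β`-self-similar Gaussian process:
`R(s,t) = s^{2β} φ(t/s)` for `0 < s ≤ t`, symmetric, and `0` if `s = 0` or `t = 0`. -/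
noncomputable def Rcov (β : ℝ) (φ : ℝ → ℝ) (s t : ℝ) : ℝ :=
  if s = 0 ∨ t = 0 then 0
  else if s ≤ t then s ^ (2 * β) * φ (t / s)
  else t ^ (2 * β) * φ (s / t)

/-- `Dn β φ n j k = E[(X_{(j+1)/n} - X_{j/n})(X_{(k+1)/n} - X_{k/n})]`, expressed via `R`. -/
noncomputable def Dn (β : ℝ) (φ : ℝ → ℝ) (n j k : ℕ) : ℝ :=
  Rcov β φ (((j : ℝ) + 1) / n) (((k : ℝ) + 1) / n)
    - Rcov β φ (((j : ℝ) + 1) / n) ((k : ℝ) / n)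
    - Rcov β φ ((j : ℝ) / n) (((k : ℝ) + 1) / n)
    + Rcov β φ ((j : ℝ) / n) ((k : ℝ) / n)

/-- First-order expansion of `(1 + h) ^ p` along `h = 1 / j`. -/
theorem tendsto_one_add_inv_rpow_sub_one_div (p : ℝ) :
    Tendsto (fun j : ℕ => ((1 + (j : ℝ)⁻¹) ^ p - 1) / (j : ℝ)⁻¹) atTop (𝓝 p) := by
  have hd : HasDerivAt (fun y : ℝ => y ^ p) p 1 := by
    simpa using Real.hasDerivAt_rpow_const (x := 1) (p := p) (Or.inl one_ne_zero)
  have hinv : Tendsto (fun j : ℕ => (j : ℝ)⁻¹) atTop (𝓝[≠] 0) := by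
    refine tendsto_nhdsWithin_iff.2 ⟨tendsto_inv_atTop_nhds_zero_nat, ?_⟩
    filter_upwards [eventually_gt_atTop 0] with j hj
    have : (j : ℝ) ≠ 0 := by positivity
    simpa using this
  refine (hd.tendsto_slope_zero.comp hinv).congr fun j => ?_
  simp [div_eq_inv_mul]

theorem tendsto_rpow_add_one_sub_div (p : ℝ) :
    Tendsto (fun j : ℕ => (((j : ℝ) + 1) ^ p - (j : ℝ) ^ p) / (j : ℝ) ^ (p - 1))
      atTop (𝓝 p) := by
  refine (tendsto_one_add_inv_rpow_sub_one_div p).congr' ?_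
  filter_upwards [eventually_gt_atTop 0] with j hj
  have hj' : (0 : ℝ) < j := by exact_mod_cast hj
  have h1 : (j : ℝ) + 1 = j * (1 + (j : ℝ)⁻¹) := by field_simp
  have hp : (0 : ℝ) < (j : ℝ) ^ p := by positivity
  rw [h1, Real.mul_rpow hj'.le (by positivity), Real.rpow_sub_one hj'.ne']
  field_simp

/-- If `a j ∼ c j ^ (p - 1)` with `p > 0`, the partial sums of `a` are `∼ (c / p) N ^ p`. -/
theorem tendsto_sum_range_div_rpow {p c : ℝ} (hp : 0 < p) {a : ℕ → ℝ}
    (ha : Tendsto (fun j : ℕ => a j / (j : ℝ) ^ (p - 1)) atTop (𝓝 c)) :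
    Tendsto (fun N : ℕ => (∑ j ∈ Finset.range N, a j) / (N : ℝ) ^ p) atTop (𝓝 (c / p)) := by
  set g : ℕ → ℝ := fun j => ((j : ℝ) + 1) ^ p - (j : ℝ) ^ p with hg
  have hgpos : ∀ j, 0 < g j := fun j =>
    sub_pos.2 (Real.rpow_lt_rpow (Nat.cast_nonneg j) (lt_add_one _) hp)
  have hsum : ∀ N : ℕ, ∑ j ∈ Finset.range N, g j = (N : ℝ) ^ p := by
    intro N
    have := Finset.sum_range_sub (fun j : ℕ => (j : ℝ) ^ p) N
    simpa [hg, Real.zero_rpow hp.ne'] using this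
  have hratio : Tendsto (fun j => a j / g j) atTop (𝓝 (c / p)) := by
    refine (ha.div (tendsto_rpow_add_one_sub_div p) hp.ne').congr' ?_
    filter_upwards [eventually_gt_atTop 0] with j hj
    have hj' : (0 : ℝ) < (j : ℝ) ^ (p - 1) := by
      have : (0 : ℝ) < j := by exact_mod_cast hj
      positivity
    exact div_div_div_cancel_right₀ hj'.ne' _ _
  have hlittle : (fun j => a j - c / p * g j) =o[atTop] g := by
    rw [Asymptotics.isLittleO_iff_tendsto fun j hj => absurd hj (hgpos j).ne']
    have := hratio.sub_const (c / p)
    rw [sub_self] at this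
    refine this.congr fun j => ?_
    have := (hgpos j).ne'
    field_simp
  have hN : Tendsto (fun N : ℕ => (N : ℝ) ^ p) atTop atTop :=
    (tendsto_rpow_atTop hp).comp tendsto_natCast_atTop_atTop
  have hS := hlittle.sum_range (fun j => (hgpos j).le) (by simpa only [hsum] using hN)
  simp only [Finset.sum_sub_distrib, ← Finset.mul_sum, hsum] at hS
  have := hS.tendsto_div_nhds_zero.add_const (c / p)
  rw [zero_add] at this
  refine this.congr' ?_
  filter_upwards [eventually_gt_atTop 0] with N hN
  have : (0 : ℝ) < (N : ℝ) ^ p := by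
    have : (0 : ℝ) < N := by exact_mod_cast hN
    positivity
  field_simp
  ring

/-- A function with bounded derivative on `(1, 2]`, continuous up to `1`, is Lipschitz at `1`. -/
theorem abs_sub_le_of_abs_deriv_le {ψ : ℝ → ℝ} {M : ℝ} (hc : ContinuousOn ψ (Set.Ici 1))
    (hd : DifferentiableOn ℝ ψ (Set.Ioi 1)) (hM : ∀ x ∈ Set.Ioc (1 : ℝ) 2, |deriv ψ x| ≤ M)
    {h : ℝ} (h0 : 0 < h) (h1 : h ≤ 1) : |ψ (1 + h) - ψ 1| ≤ M * h := by
  obtain ⟨y, hy, hyeq⟩ := exists_deriv_eq_slope ψ (by linarith : (1 : ℝ) < 1 + h)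
    (hc.mono Set.Icc_subset_Ici_self) (hd.mono Set.Ioo_subset_Ioi_self)
  have hb := hM y ⟨hy.1, by linarith [hy.2]⟩
  rw [hyeq, add_sub_cancel_left, abs_div, abs_of_pos h0, div_le_iff₀ h0] at hb
  exact hb

theorem Dn_one_diag (β : ℝ) (φ : ℝ → ℝ) {j : ℕ} (hj : 0 < j) :
    Dn β φ 1 j j = φ 1 * (((j : ℝ) + 1) ^ (2 * β) - (j : ℝ) ^ (2 * β))
      + 2 * (j : ℝ) ^ (2 * β) * (φ 1 - φ (1 + (j : ℝ)⁻¹)) := by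
  have hj' : (0 : ℝ) < j := by exact_mod_cast hj
  have h1 : (j : ℝ) + 1 ≠ 0 := by positivity
  have h2 : ¬ ((j : ℝ) + 1 ≤ j) := by linarith
  have h3 : ((j : ℝ) + 1) / j = 1 + (j : ℝ)⁻¹ := by field_simp
  simp only [Dn, Rcov, Nat.cast_one, div_one, h1, hj'.ne', or_self, if_false, le_refl, if_true, h2,
    div_self h1, div_self hj'.ne', h3, (lt_add_one (j : ℝ)).le]
  ring

/-- The increment variance satisfies `Dn β φ 1 j j ∼ 2 λ j ^ (2 β - α)`. -/
theorem tendsto_Dn_one_diag_div {α β lam : ℝ} {φ : ℝ → ℝ} (hα : 0 < α) (hα1 : α < 1)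
    (hφc : ContinuousOn φ (Set.Ici 1)) (hφ2 : ContDiffOn ℝ 2 φ (Set.Ioi 1))
    (hH1 : ∃ M : ℝ, ∀ x ∈ Set.Ioc (1 : ℝ) 2,
      |deriv (fun y => φ y + lam * (y - 1) ^ α) x| ≤ M) :
    Tendsto (fun j : ℕ => Dn β φ 1 j j / (j : ℝ) ^ (2 * β - α)) atTop (𝓝 (2 * lam)) := by
  obtain ⟨M, hM⟩ := hH1
  set ψ : ℝ → ℝ := fun y => φ y + lam * (y - 1) ^ α with hψ
  have hψc : ContinuousOn ψ (Set.Ici 1) := by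
    refine hφc.add (continuousOn_const.mul ?_)
    exact (Continuous.rpow_const (by fun_prop) fun _ => Or.inr hα.le).continuousOn
  have hψd : DifferentiableOn ℝ ψ (Set.Ioi 1) := by
    refine (hφ2.differentiableOn (by norm_num)).add ((differentiableOn_const _).mul ?_)
    intro y hy
    have : y - 1 ≠ 0 := (sub_pos.2 hy).ne'
    have hid : DifferentiableAt ℝ (fun z : ℝ => z - 1) y := by fun_prop
    exact (hid.rpow_const (Or.inl this)).differentiableWithinAt
  have hpow : Tendsto (fun j : ℕ => (j : ℝ)⁻¹ ^ (1 - α)) atTop (𝓝 0) := by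
    have := tendsto_inv_atTop_nhds_zero_nat (𝕜 := ℝ).rpow_const
      (p := 1 - α) (Or.inr (by linarith))
    rwa [Real.zero_rpow (by linarith)] at this
  have hfst : Tendsto (fun j : ℕ => φ 1 * (((1 + (j : ℝ)⁻¹) ^ (2 * β) - 1) / (j : ℝ)⁻¹
      * (j : ℝ)⁻¹ ^ (1 - α))) atTop (𝓝 0) := by
    simpa using ((tendsto_one_add_inv_rpow_sub_one_div (2 * β)).mul hpow).const_mul (φ 1)
  have hsnd : Tendsto (fun j : ℕ => 2 * ((ψ 1 - ψ (1 + (j : ℝ)⁻¹)) / (j : ℝ)⁻¹ ^ α))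
      atTop (𝓝 0) := by
    have : Tendsto (fun j : ℕ => (ψ 1 - ψ (1 + (j : ℝ)⁻¹)) / (j : ℝ)⁻¹ ^ α)
        atTop (𝓝 0) := by
      refine squeeze_zero_norm' ?_ (by simpa using hpow.const_mul M)
      filter_upwards [eventually_gt_atTop 0] with j hj
      have hj' : (0 : ℝ) < (j : ℝ)⁻¹ := by positivity
      have hj1 : (j : ℝ)⁻¹ ≤ 1 := inv_le_one_of_one_le₀ (by exact_mod_cast hj)
      have hb := abs_sub_le_of_abs_deriv_le hψc hψd hM hj' hj1
      have hpos : (0 : ℝ) < (j : ℝ)⁻¹ ^ α := by positivity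
      rw [Real.norm_eq_abs, abs_div, abs_of_pos hpos, abs_sub_comm, Real.rpow_sub hj',
        Real.rpow_one, ← mul_div_assoc]
      gcongr
    simpa using this.const_mul 2
  have hlim := (hfst.add hsnd).add_const (2 * lam)
  rw [add_zero, zero_add] at hlim
  refine hlim.congr' ?_
  filter_upwards [eventually_gt_atTop 0] with j hj
  have hj' : (0 : ℝ) < j := by exact_mod_cast hj
  have h1 : (j : ℝ) + 1 = j * (1 + (j : ℝ)⁻¹) := by field_simp
  have hA : (0 : ℝ) < (j : ℝ) ^ α := by positivity
  have hB : (0 : ℝ) < (j : ℝ) ^ (2 * β) := by positivity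
  have hψ1 : ψ 1 = φ 1 := by simp [hψ, Real.zero_rpow hα.ne']
  have hψh : ψ (1 + (j : ℝ)⁻¹) = φ (1 + (j : ℝ)⁻¹) + lam * ((j : ℝ) ^ α)⁻¹ := by
    simp [hψ, Real.inv_rpow hj'.le]
  rw [Dn_one_diag β φ hj, hψ1, hψh, h1, Real.mul_rpow hj'.le (by positivity),
    Real.rpow_sub hj', Real.rpow_sub (by positivity), Real.rpow_one, Real.inv_rpow hj'.le]
  field_simp
  ring

theorem tendsto_natCast_add_div_natCast (x : ℕ) :
    Tendsto (fun j : ℕ => ((j + x : ℕ) : ℝ) / (j : ℝ)) atTop (𝓝 1) := by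
  have := (tendsto_inv_atTop_nhds_zero_nat (𝕜 := ℝ)).const_mul (x : ℝ) |>.const_add 1
  rw [mul_zero, add_zero] at this
  refine this.congr' ?_
  filter_upwards [eventually_gt_atTop 0] with j hj
  have hj' : (0 : ℝ) < j := by exact_mod_cast hj
  push_cast
  field_simp

/-- Regularly varying asymptotics are insensitive to a fixed shift of the index. -/
theorem tendsto_shift_div_rpow {q c : ℝ} {d : ℕ → ℝ}
    (hd : Tendsto (fun j : ℕ => d j / (j : ℝ) ^ q) atTop (𝓝 c)) (x : ℕ) :
    Tendsto (fun j : ℕ => d (j + x) / (j : ℝ) ^ q) atTop (𝓝 c) := by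
  have h1 := hd.comp (tendsto_add_atTop_nat x)
  have h2 := (tendsto_natCast_add_div_natCast x).rpow_const (p := q) (Or.inl one_ne_zero)
  have := h1.mul h2
  rw [Real.one_rpow, mul_one] at this
  refine this.congr' ?_
  filter_upwards [eventually_gt_atTop 0] with j hj
  have hj' : (0 : ℝ) < j := by exact_mod_cast hj
  have hjx : (0 : ℝ) < ((j + x : ℕ) : ℝ) := by positivity
  have : (0 : ℝ) < ((j + x : ℕ) : ℝ) ^ q := by positivity
  simp only [Function.comp_apply]
  rw [Real.div_rpow hjx.le hj'.le]
  field_simp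

theorem tendsto_sqrt_pow_mul_sqrt_pow_div {q c : ℝ} (hc : 0 ≤ c) {d e : ℕ → ℝ}
    (hd : Tendsto (fun j : ℕ => d j / (j : ℝ) ^ q) atTop (𝓝 c))
    (he : Tendsto (fun j : ℕ => e j / (j : ℝ) ^ q) atTop (𝓝 c)) (m : ℕ) :
    Tendsto (fun j : ℕ => √(d j) ^ m * √(e j) ^ m / (j : ℝ) ^ (q * m)) atTop (𝓝 (c ^ m)) := by
  have := (hd.sqrt.pow m).mul (he.sqrt.pow m)
  rw [← mul_pow, Real.mul_self_sqrt hc] at this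
  refine this.congr fun j => ?_
  have hj : (0 : ℝ) ≤ (j : ℝ) ^ q := by positivity
  rw [Real.sqrt_div' _ hj, Real.sqrt_div' _ hj, div_pow, div_pow, div_mul_div_comm,
    ← mul_pow √((j : ℝ) ^ q), Real.mul_self_sqrt hj, Real.rpow_mul (Nat.cast_nonneg j), Real.rpow_natCast]

theorem tendsto_floor_mul_sub_div {t : ℝ} (ht : 0 < t) (x : ℕ) :
    Tendsto (fun n : ℕ => ((⌊(n : ℝ) * t⌋₊ - x : ℕ) : ℝ) / n) atTop (𝓝 t) := by
  have h1 := (tendsto_nat_floor_mul_div_atTop ht.le).comp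
    (tendsto_natCast_atTop_atTop (R := ℝ))
  have h2 := (tendsto_inv_atTop_nhds_zero_nat (𝕜 := ℝ)).const_mul (x : ℝ)
  have := h1.sub h2
  rw [mul_zero, sub_zero] at this
  refine this.congr' ?_
  have hfl : Tendsto (fun n : ℕ => ⌊(n : ℝ) * t⌋₊) atTop atTop :=
    tendsto_nat_floor_atTop.comp (tendsto_natCast_atTop_atTop.atTop_mul_const ht)
  filter_upwards [hfl.eventually_ge_atTop x] with n hn
  rw [Nat.cast_sub hn]
  simp only [Function.comp_apply, mul_comm t]
  ring

theorem stmt_15 (α β lam : ℝ) (φ : ℝ → ℝ) (ℓ : ℕ) (hℓ : 1 ≤ ℓ)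
    (hαℓ : α = 1 / (2 * (ℓ : ℝ) + 1))
    (hα : 0 < α) (hα1 : α < 1) (hβ : 0 < β) (hβ2 : β ≤ 1 / 2) (hαβ : α ≤ 2 * β)
    (hφc : ContinuousOn φ (Set.Ici 1)) (hφ2 : ContDiffOn ℝ 2 φ (Set.Ioi 1))
    (hlam : 0 < lam)
    (hH1 : ∃ M : ℝ, ∀ x ∈ Set.Ioc (1 : ℝ) 2,
      |deriv (fun y => φ y + lam * (y - 1) ^ α) x| ≤ M)
    (hpos : ∀ j : ℕ, 0 ≤ Dn β φ 1 j j) :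
    ∀ t : ℝ, 0 < t → ∀ x : ℕ,
      Filter.Tendsto (fun n : ℕ =>
          (n : ℝ) ^ (-(2 * β / α)) * ∑ j ∈ Finset.range (⌊(n : ℝ) * t⌋₊ - x),
            Real.sqrt (Dn β φ 1 j j) ^ (2 * ℓ + 1)
              * Real.sqrt (Dn β φ 1 (j + x) (j + x)) ^ (2 * ℓ + 1))
        Filter.atTop
        (nhds (α / (2 * β) * (2 * lam) ^ (2 * ℓ + 1) * t ^ (2 * β / α))) := by
  intro t ht x
  have hm : α * ((2 * ℓ + 1 : ℕ) : ℝ) = 1 := by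
    rw [hαℓ]
    push_cast
    field_simp
  have hp : 0 < 2 * β / α := by positivity
  have hexp : (2 * β - α) * ((2 * ℓ + 1 : ℕ) : ℝ) = 2 * β / α - 1 := by
    rw [eq_sub_iff_add_eq, eq_div_iff hα.ne']
    linear_combination (2 * β - α) * hm
  have hD := tendsto_Dn_one_diag_div (β := β) hα hα1 hφc hφ2 hH1
  have hprod := tendsto_sqrt_pow_mul_sqrt_pow_div (by positivity) hD
    (tendsto_shift_div_rpow hD x) (2 * ℓ + 1)
  rw [hexp] at hprod
  have hsum := tendsto_sum_range_div_rpow hp hprod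
  have hfloor := tendsto_floor_mul_sub_div ht x
  have hN : Tendsto (fun n : ℕ => ⌊(n : ℝ) * t⌋₊ - x) atTop atTop :=
    (tendsto_sub_atTop_nat x).comp
      (tendsto_nat_floor_atTop.comp (tendsto_natCast_atTop_atTop.atTop_mul_const ht))
  have hlim := (hsum.comp hN).mul (hfloor.rpow_const (p := 2 * β / α) (Or.inl ht.ne'))
  have hconst : (2 * lam) ^ (2 * ℓ + 1) / (2 * β / α) * t ^ (2 * β / α)
      = α / (2 * β) * (2 * lam) ^ (2 * ℓ + 1) * t ^ (2 * β / α) := by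
    field_simp
  rw [hconst] at hlim
  refine hlim.congr' ?_
  filter_upwards [hN.eventually_gt_atTop 0, eventually_gt_atTop 0] with n hNn hn
  have hn' : (0 : ℝ) < n := by exact_mod_cast hn
  have hNn' : (0 : ℝ) < ((⌊(n : ℝ) * t⌋₊ - x : ℕ) : ℝ) := by exact_mod_cast hNn
  have hNp : (0 : ℝ) < ((⌊(n : ℝ) * t⌋₊ - x : ℕ) : ℝ) ^ (2 * β / α) := by positivity
  simp only [Function.comp_apply]
  rw [Real.div_rpow hNn'.le hn'.le, Real.rpow_neg hn'.le, div_mul_div_cancel₀ hNp.ne',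
    div_eq_inv_mul]
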